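/- The Thue–Morse Laurent series τ(t) = Σ_{n=1}^∞ τ_n t^{-n} ∈ F_2((t^{-1})) exhibits full generic escape of mass with respect to the sequence {t^k}_{k≥0}; that is, for every ε > 0, lim_{n→∞} d({k ∈ ℕ : e_{k,n}(τ) > 1 − ε}) = 1. -/

import Mathlib

open scoped Classical
open Filter Polynomial

noncomputable section

namespace EscapeOfMass

variable {K : Type*} [Field K]

/-- The element `t` of `K((t⁻¹))`, modelled as the Laurent series field `K⸨X⸩`
in the variable `X = t⁻¹`; thus `t = X⁻¹ = single (-1) 1`. -/
def tLS (K : Type*) [Field K] : LaurentSeries K := HahnSeries.single (-1 : ℤ) 1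

/-- The polynomial part of a Laurent series in `K((t⁻¹))` (the terms with
non-negative powers of `t`, i.e. non-positive powers of `X`). -/
def polyPart (f : LaurentSeries K) : LaurentSeries K :=
  { coeff := fun n => if n ≤ 0 then f.coeff n else 0
    isPWO_support' := by
      refine f.isPWO_support'.mono fun n hn => ?_
      simp only [Function.mem_support, ne_eq] at hn ⊢
      intro h
      exact hn (by simp [h]) }

/-- The fractional part `⟨f⟩` of a Laurent series in `K((t⁻¹))`. -/
def fracPart (f : LaurentSeries K) : LaurentSeries K := f - polyPart f

/-- The complete quotients of the continued fraction expansion of `f`. -/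
def cfQuot (f : LaurentSeries K) : ℕ → LaurentSeries K
  | 0 => f
  | i + 1 => (cfQuot f i - polyPart (cfQuot f i))⁻¹

/-- The partial quotients `A_i` of the continued fraction expansion of `f`. -/
def cfPQ (f : LaurentSeries K) (i : ℕ) : LaurentSeries K := polyPart (cfQuot f i)

/-- The degree (as an integer) of a Laurent series viewed in `K((t⁻¹))`:
for a nonzero polynomial in `t` this is the usual degree. -/
def degZ (f : LaurentSeries K) : ℤ := -f.order

/-- `f` is a rational Laurent series, i.e. lies in `K(t)`. -/
def IsRatLS (f : LaurentSeries K) : Prop := ∃ r : RatFunc K, (r : LaurentSeries K) = f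

/-- `f` is a quadratic irrational: it is irrational and a root of a quadratic
polynomial with coefficients in `K[t]`. -/
def IsQuadIrr (f : LaurentSeries K) : Prop :=
  ¬ IsRatLS f ∧ ∃ a b c : Polynomial K, a ≠ 0 ∧
    Polynomial.aeval (tLS K) a * f ^ 2 + Polynomial.aeval (tLS K) b * f +
      Polynomial.aeval (tLS K) c = 0

/-- `(m, ℓ)` is a window for the periodic part of the continued fraction of `f`:
the partial quotients are periodic with period `ℓ ≥ 1` from index `m + 1` on. -/
def PeriodWindow (f : LaurentSeries K) (m ℓ : ℕ) : Prop :=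
  1 ≤ ℓ ∧ ∀ i : ℕ, m + 1 ≤ i → cfPQ f (i + ℓ) = cfPQ f i

/-- The `n`-escape of mass of the continued fraction expansion of `f`: the proportion,
within one period of the periodic part of the partial quotients of `f`, of the sum
`∑ max (deg A_i - n) 0` relative to `∑ deg A_i`. -/
def eMassOf (f : LaurentSeries K) (n : ℕ) : ℝ :=
  if h : ∃ s : ℕ × ℕ, PeriodWindow f s.1 s.2 then
    (∑ i ∈ Finset.Ico ((Classical.choose h).1 + 1)
        ((Classical.choose h).1 + 1 + (Classical.choose h).2),
        max ((degZ (cfPQ f i) : ℝ) - n) 0) /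
    (∑ i ∈ Finset.Ico ((Classical.choose h).1 + 1)
        ((Classical.choose h).1 + 1 + (Classical.choose h).2),
        (degZ (cfPQ f i) : ℝ))
  else 0

/-- The `n`-escape of mass in the `k`-th diagonal of `f` with respect to the
sequence `{g^k}`. -/
def eMassP (g f : LaurentSeries K) (k n : ℕ) : ℝ := eMassOf (g ^ k * f) n

/-- The `n`-escape of mass in the `k`-th diagonal of `f` with respect to `{t^k}`. -/
def eMass (f : LaurentSeries K) (k n : ℕ) : ℝ := eMassP (tLS K) f k n

/-- `f` exhibits `c` escape of mass with respect to the sequence `{g^k}`. -/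
def ExhibitsEscape (g f : LaurentSeries K) (c : ℝ) : Prop :=
  ∃ L : ℝ, Tendsto (fun n : ℕ => Filter.liminf (fun k : ℕ => eMassP g f k n) atTop)
    atTop (nhds L) ∧ c ≤ L

/-- `f` exhibits exactly `c` escape of mass with respect to the sequence `{g^k}`. -/
def ExhibitsExactEscape (g f : LaurentSeries K) (c : ℝ) : Prop :=
  Tendsto (fun n : ℕ => Filter.liminf (fun k : ℕ => eMassP g f k n) atTop)
    atTop (nhds c)

/-- `f` exhibits full (`c = 1`) maximal escape of mass with respect to `{g^k}`. -/
def ExhibitsFullMaxEscape (g f : LaurentSeries K) : Prop :=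
  Tendsto (fun n : ℕ => Filter.limsup (fun k : ℕ => eMassP g f k n) atTop)
    atTop (nhds 1)

/-- `A ⊆ ℕ` has natural density `c`. -/
def HasDensity (A : Set ℕ) (c : ℝ) : Prop :=
  Tendsto (fun M : ℕ => (((Finset.Icc 1 M).filter fun k => k ∈ A).card : ℝ) / M)
    atTop (nhds c)

/-- `f` exhibits full generic escape of mass with respect to `{t^k}`. -/
def FullGenericEscape (f : LaurentSeries K) : Prop :=
  ∀ ε : ℝ, 0 < ε → ∃ dens : ℕ → ℝ,
    (∀ n : ℕ, HasDensity {k : ℕ | 1 - ε < eMass f k n} (dens n)) ∧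
    Tendsto dens atTop (nhds 1)

/-- Substitution `t ↦ P(t)` on Laurent series: for `f = ∑_{i ≥ d} a_i t^{-i}` (with
`d = f.order` in the variable `X = t⁻¹`), `substLS f P = ∑_{i ≥ d} a_i P(t)^{-i}`. -/
def substLS (f : LaurentSeries K) (P : Polynomial K) : LaurentSeries K :=
  (Polynomial.aeval (tLS K) P)⁻¹ ^ f.order *
    HahnSeries.ofPowerSeries ℤ K
      (PowerSeries.mk fun n =>
        ∑ j ∈ Finset.range (n + 1),
          f.coeff (f.order + j) * (((Polynomial.aeval (tLS K) P)⁻¹ ^ j).coeff (n : ℤ)))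

/-- The `p`-Cantor sequence over `ZMod p`. -/
def cantor (p : ℕ) : ℕ → ZMod p
  | 0 => 1
  | (n + 1) =>
    if hp : 1 < p then
      if (n + 1) % p % 2 = 1 then 0
      else (((p - 1) / 2).choose (((n + 1) % p) / 2) : ZMod p) * cantor p ((n + 1) / p)
    else 0
  decreasing_by exact Nat.div_lt_self (Nat.succ_pos _) hp

/-- `Θ̃_p = ∑_{i ≥ 0} c_i^{(p)} t^{-i}`. -/
def cantorTilde (p : ℕ) : LaurentSeries (ZMod p) :=
  HahnSeries.ofPowerSeries ℤ (ZMod p) (PowerSeries.mk fun i => cantor p i)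

/-- `Θ_p = t⁻¹ ∑_{i ≥ 0} c_i^{(p)} t^{-i}`. -/
def cantorTheta (p : ℕ) : LaurentSeries (ZMod p) :=
  HahnSeries.single (1 : ℤ) 1 * cantorTilde p

/-- The Thue–Morse sequence over `ZMod 2`. -/
def thueMorse (n : ℕ) : ZMod 2 := ((Nat.digits 2 n).sum : ZMod 2)

/-- The Thue–Morse Laurent series `τ = ∑_{n ≥ 1} τ_n t^{-n}`. -/
def tmSeries : LaurentSeries (ZMod 2) :=
  HahnSeries.ofPowerSeries ℤ (ZMod 2) (PowerSeries.mk fun n => thueMorse n)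

/-- The extension of a one-sided sequence to `ℤ` by zero. -/
def extendSeq (S : ℕ → K) : ℤ → K := fun i => if 0 ≤ i then S i.toNat else 0

/-- The entry `W(S)[m, n]` of the number wall of the (doubly infinite) sequence `s`:
the determinant of the `(m+1) × (m+1)` Toeplitz matrix `(s_{n - i + j})`. -/
def wallEntry (s : ℤ → K) (m : ℕ) (n : ℤ) : K :=
  (Matrix.of fun i j : Fin (m + 1) => s (n - (i : ℕ) + (j : ℕ))).det

/-- The Laurent series `t⁻¹ ∑_{i ≥ 0} s_i t^{-i}` associated to a sequence. -/
def seriesOf (S : ℕ → K) : LaurentSeries K :=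
  HahnSeries.single (1 : ℤ) 1 * HahnSeries.ofPowerSeries ℤ K (PowerSeries.mk S)

/-- The coefficient sequence of `Θ = t⁻¹ ∑ s_i t^{-i}`, extended to `ℤ` by zero. -/
def coeffSeq (f : LaurentSeries K) : ℤ → K := fun i => if 0 ≤ i then f.coeff (i + 1) else 0

/-- The absolute value of a Laurent series in `F_q((t⁻¹))`: `|f| = q^{deg f}`. -/
def absLS {K : Type*} [Field K] [Fintype K] (f : LaurentSeries K) : ℝ :=
  if f = 0 then 0 else (Fintype.card K : ℝ) ^ (-f.order)


/-! ### Basic tools -/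

abbrev LL := LaurentSeries (ZMod 2)

/-- order at least `v` -/
def og (f : LL) (v : ℤ) : Prop := (v : WithTop ℤ) ≤ f.orderTop

theorem og_iff {f : LL} {v : ℤ} : og f v ↔ ∀ n : ℤ, n < v → f.coeff n = 0 := by
  unfold og
  rw [HahnSeries.le_orderTop_iff_forall]
  simp

theorem og_mono {f : LL} {v w : ℤ} (h : og f v) (hw : w ≤ v) : og f w :=
  le_trans (by exact_mod_cast hw) h

theorem og_add {f g : LL} {v : ℤ} (h : og f v) (h' : og g v) : og (f + g) v :=
  le_trans (le_min h h') HahnSeries.min_orderTop_le_orderTop_add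

theorem og_sub {f g : LL} {v : ℤ} (h : og f v) (h' : og g v) : og (f - g) v :=
  le_trans (le_min h h') HahnSeries.min_orderTop_le_orderTop_sub

theorem og_mul {f g : LL} {v w : ℤ} (h : og f v) (h' : og g w) : og (f * g) (v + w) := by
  unfold og at *
  rw [HahnSeries.orderTop_mul]
  push_cast
  exact add_le_add h h'

theorem og_order {f : LL} (hf : f ≠ 0) {v : ℤ} : og f v ↔ v ≤ f.order := by
  unfold og
  rw [← HahnSeries.order_eq_orderTop_of_ne_zero hf]
  simp

theorem og_zero (v : ℤ) : og 0 v := by simp [og]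

theorem og_of_mul {f g : LL} (hf : f ≠ 0) {v : ℤ} (h : og (f * g) v) : og g (v - f.order) := by
  by_cases hg : g = 0
  · subst hg; exact og_zero _
  · rw [og_order (mul_ne_zero hf hg), HahnSeries.order_mul hf hg] at h
    rw [og_order hg]; omega

theorem og_mul_iff {f g : LL} (hf : f ≠ 0) {v w : ℤ} (hw : w = v + f.order) :
    og (f * g) w ↔ og g v := by
  constructor
  · intro h
    have := og_of_mul hf h
    exact og_mono this (by omega)
  · intro h
    have := og_mul ((og_order hf).2 le_rfl) h
    exact og_mono this (by omega)

abbrev tt : LL := tLS (ZMod 2)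

theorem tt_ne : tt ≠ 0 := by simp [tt, tLS]

theorem tt_order : tt.order = -1 := by simp [tt, tLS]

abbrev ev : (ZMod 2)[X] →ₐ[ZMod 2] LL := Polynomial.aeval tt

theorem tt_pow (n : ℕ) : tt ^ n = HahnSeries.single (-(n : ℤ)) 1 := by
  simp [tt, tLS, HahnSeries.single_pow]

theorem ev_coeff (p : (ZMod 2)[X]) (n : ℤ) :
    (ev p).coeff n = if n ≤ 0 then p.coeff (-n).toNat else 0 := by
  induction p using Polynomial.induction_on' with
  | add p q hp hq => 
    rw [map_add, HahnSeries.coeff_add, hp, hq]; split_ifs <;> simp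
  | monomial k a =>
    rw [Polynomial.aeval_monomial, tt_pow, HahnSeries.algebraMap_apply',
      show (algebraMap (ZMod 2) (PowerSeries (ZMod 2))) a = PowerSeries.C a from rfl,
      HahnSeries.ofPowerSeries_C, HahnSeries.C_mul_eq_smul,
      HahnSeries.coeff_smul, HahnSeries.coeff_single, Polynomial.coeff_monomial]
    by_cases h : n = -(k : ℤ)
    · subst h; simp
    · rw [if_neg h]
      split_ifs with h1 h2
      · omega
      · simp
      · simp

theorem ev_inj {p : (ZMod 2)[X]} : ev p = 0 ↔ p = 0 := by
  constructor
  · intro h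
    ext n
    have := ev_coeff p (-(n : ℤ))
    rw [h] at this
    simp at this
    simp [← this]
  · rintro rfl; simp

theorem og_ev {p : (ZMod 2)[X]} {d : ℕ} : og (ev p) (-(d : ℤ)) ↔ p.degree < ((d + 1 : ℕ) : WithBot ℕ) := by
  rw [og_iff, Polynomial.degree_lt_iff_coeff_zero]
  constructor
  · intro h m hm
    have := h (-(m : ℤ)) (by omega)
    rw [ev_coeff] at this
    simpa using this
  · intro h n hn
    rw [ev_coeff]
    split_ifs
    · apply h; omega
    · rfl

theorem ev_eq_zero_of_og {p : (ZMod 2)[X]} (h : og (ev p) 1) : p = 0 := by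
  rw [← ev_inj]
  ext n
  rw [og_iff] at h
  by_cases hn : n < 1
  · rw [h n hn]; rfl
  · rw [ev_coeff, if_neg (by omega)]; rfl

theorem polyPart_coeff (f : LL) (n : ℤ) : (polyPart f).coeff n = if n ≤ 0 then f.coeff n else 0 := rfl

theorem exists_poly (f : LL) : ∃ p : (ZMod 2)[X], ev p = polyPart f := by
  classical
  obtain ⟨N, hN⟩ : ∃ N : ℕ, og f (-(N : ℤ)) := by
    by_cases hf : f = 0
    · exact ⟨0, hf ▸ og_zero _⟩
    · exact ⟨(-f.order).toNat, (og_order hf).2 (by omega)⟩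
  refine ⟨∑ i ∈ Finset.range (N + 1), Polynomial.monomial i (f.coeff (-(i : ℤ))), ?_⟩
  ext n
  rw [ev_coeff, polyPart_coeff]
  split_ifs with h
  · rw [Polynomial.finsetSum_coeff]
    simp only [Polynomial.coeff_monomial]
    rw [Finset.sum_ite_eq' (Finset.range (N + 1))]
    split_ifs with h2
    · congr 1; omega
    · rw [og_iff] at hN
      rw [hN]
      simp at h2; omega
  · rfl

theorem og_frac (f : LL) : og (f - polyPart f) 1 := by
  rw [og_iff]
  intro n hn
  rw [HahnSeries.coeff_sub, polyPart_coeff, if_pos (by omega), sub_self]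

/-- existence of a short vector -/
def SV (θ : LL) (u v : ℤ) : Prop :=
  ∃ P Q : (ZMod 2)[X], (P ≠ 0 ∨ Q ≠ 0) ∧ og (ev Q) (1 - u) ∧ og (ev Q * θ + ev P) (v + 1)

theorem SV_mono {θ : LL} {u v u' v' : ℤ} (h : SV θ u v) (hu : u ≤ u') (hv : v' ≤ v) : SV θ u' v' := by
  obtain ⟨P, Q, h0, h1, h2⟩ := h
  exact ⟨P, Q, h0, og_mono h1 (by omega), og_mono h2 (by omega)⟩

theorem og_tt : og tt (-1) := by rw [og_order tt_ne, tt_order]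

theorem ev_X : ev X = tt := by simp

theorem SV_up {θ : LL} {u v : ℤ} (h : SV θ u v) : SV (tt * θ) u (v - 1) := by
  obtain ⟨P, Q, h0, h1, h2⟩ := h
  refine ⟨X * P, Q, ?_, h1, ?_⟩
  · rcases h0 with h | h
    · exact Or.inl (mul_ne_zero X_ne_zero h)
    · exact Or.inr h
  · have : ev Q * (tt * θ) + ev (X * P) = tt * (ev Q * θ + ev P) := by
      rw [map_mul, ev_X]; ring
    rw [this]
    exact og_mono (og_mul og_tt h2) (by omega)

theorem SV_down {θ : LL} {u v : ℤ} (h : SV (tt * θ) u v) : SV θ (u + 1) v := by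
  obtain ⟨P, Q, h0, h1, h2⟩ := h
  refine ⟨P, X * Q, ?_, ?_, ?_⟩
  · rcases h0 with h | h
    · exact Or.inl h
    · exact Or.inr (mul_ne_zero X_ne_zero h)
  · rw [map_mul, ev_X]
    exact og_mono (og_mul og_tt h1) (by omega)
  · have : ev (X * Q) * θ + ev P = ev Q * (tt * θ) + ev P := by
      rw [map_mul, ev_X]; ring
    rwa [this]

theorem two_LL : (2 : LL) = 0 := by
  have : (2 : LL) = algebraMap (ZMod 2) LL 2 := (map_ofNat (algebraMap (ZMod 2) LL) 2).symm
  rw [this, show (2 : ZMod 2) = 0 from rfl, map_zero]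

theorem og_s : og (tt + 1) (-1) := og_add og_tt (by
  rw [og_order one_ne_zero]; simp)

theorem SV_double {φ : LL} (hφ : φ ^ 2 = (tt + 1) * φ + (tt + 1)) {k : ℕ} {u v : ℤ}
    (h : SV (tt ^ k * φ) u v) : SV (tt ^ (2 * k) * φ) (2 * u) (2 * v + 1) := by
  obtain ⟨P, Q, h0, h1, h2⟩ := h
  have hX : (X + 1 : (ZMod 2)[X]) ≠ 0 := by
    have := Polynomial.X_add_C_ne_zero (1 : ZMod 2)
    simpa using this
  refine ⟨P ^ 2 + (X + 1) * Q ^ 2 * X ^ (2 * k), (X + 1) * Q ^ 2, ?_, ?_, ?_⟩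
  · by_cases hQ : Q = 0
    · subst hQ
      left
      simpa using h0
    · right
      exact mul_ne_zero hX (pow_ne_zero _ hQ)
  · have : ev ((X + 1) * Q ^ 2) = (tt + 1) * (ev Q * ev Q) := by
      simp [pow_two]
    rw [this]
    exact og_mono (og_mul og_s (og_mul h1 h1)) (by omega)
  · have : ev ((X + 1) * Q ^ 2) * (tt ^ (2 * k) * φ) +
        ev (P ^ 2 + (X + 1) * Q ^ 2 * X ^ (2 * k)) =
        (ev Q * (tt ^ k * φ) + ev P) * (ev Q * (tt ^ k * φ) + ev P) := by
      simp only [map_add, map_mul, map_pow, map_one, ev_X]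
      linear_combination (-(ev Q ^ 2 * tt ^ (2 * k))) * hφ - (ev Q * tt ^ k * φ * ev P) * two_LL
    rw [this]
    exact og_mono (og_mul h2 h2) (by omega)

/-! ### Plus lemma -/

theorem f2_pigeon : ∀ a1 a2 a3 a4 b1 b2 b3 b4 : ZMod 2,
    ((a1 = 0 ∧ a2 = 0) ∨ (a1 = 0 ∧ a3 = 0) ∨ (a1 = 0 ∧ a4 = 0) ∨ (a2 = 0 ∧ a3 = 0) ∨
      (a2 = 0 ∧ a4 = 0) ∨ (a3 = 0 ∧ a4 = 0)) ∨
    ((b1 = 0 ∧ b2 = 0) ∨ (b1 = 0 ∧ b3 = 0) ∨ (b1 = 0 ∧ b4 = 0) ∨ (b2 = 0 ∧ b3 = 0) ∨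
      (b2 = 0 ∧ b4 = 0) ∨ (b3 = 0 ∧ b4 = 0)) ∨
    ((a1 + b1 = 0 ∧ a2 + b2 = 0) ∨ (a1 + b1 = 0 ∧ a3 + b3 = 0) ∨ (a1 + b1 = 0 ∧ a4 + b4 = 0) ∨
      (a2 + b2 = 0 ∧ a3 + b3 = 0) ∨
      (a2 + b2 = 0 ∧ a4 + b4 = 0) ∨ (a3 + b3 = 0 ∧ a4 + b4 = 0)) := by
  intro a1 a2 a3 a4 b1 b2 b3 b4
  have h : ∀ a b : ZMod 2, a = 0 ∨ b = 0 ∨ a + b = 0 := by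
    intro a b
    fin_cases a <;> fin_cases b
    · left; rfl
    · left; rfl
    · right; left; rfl
    · right; right; rfl
  rcases h a1 b1 with h1 | h1 | h1 <;> rcases h a2 b2 with h2 | h2 | h2 <;>
    rcases h a3 b3 with h3 | h3 | h3 <;> rcases h a4 b4 with h4 | h4 | h4 <;>
    simp only [h1, h2, h3, h4, true_and, and_true, true_or, or_true]

/-- coefficient functional -/
def cf (θ : LL) (n : ℤ) : (ZMod 2)[X] →ₗ[ZMod 2] ZMod 2 where
  toFun Q := (ev Q * θ).coeff n
  map_add' x y := by simp [add_mul]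
  map_smul' c x := by
    have h : ∀ c : ZMod 2, c = 0 ∨ c = 1 := by decide
    rcases h c with rfl | rfl
    · simp
    · simp

theorem cf_apply (θ : LL) (n : ℤ) (Q : (ZMod 2)[X]) : cf θ n Q = (ev Q * θ).coeff n := rfl

theorem exists_pair (θ : LL) {d : ℕ} (hd : 1 ≤ d) : ∃ a b : (ZMod 2)[X], a ≠ 0 ∧ b ≠ 0 ∧ a + b ≠ 0 ∧
    (a.degree < ((d + 1 : ℕ) : WithBot ℕ)) ∧ (b.degree < ((d + 1 : ℕ) : WithBot ℕ)) ∧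
    ∀ n : ℤ, 1 ≤ n → n < d → cf θ n a = 0 ∧ cf θ n b = 0 := by
  let V := Polynomial.degreeLT (ZMod 2) (d + 1)
  let g : V →ₗ[ZMod 2] (Fin (d - 1) → ZMod 2) :=
    LinearMap.pi fun i => (cf θ ((i : ℕ) + 1)).comp V.subtype
  have hV : Module.finrank (ZMod 2) V = d + 1 := by
    rw [(Polynomial.degreeLTEquiv (ZMod 2) (d + 1)).finrank_eq]; simp
  have : Module.Finite (ZMod 2) V := Module.Finite.equiv (Polynomial.degreeLTEquiv (ZMod 2) (d + 1)).symm
  have h1 := LinearMap.finrank_range_add_finrank_ker g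
  have h2 : Module.finrank (ZMod 2) (LinearMap.range g) ≤ d - 1 := by
    have := Submodule.finrank_le (LinearMap.range g)
    simpa using this
  have h3 : 1 < Module.finrank (ZMod 2) (LinearMap.ker g) := by omega
  have : Nontrivial (LinearMap.ker g) := Module.nontrivial_of_finrank_pos (R := ZMod 2) (by omega)
  obtain ⟨x, hx⟩ := exists_ne (0 : LinearMap.ker g)
  obtain ⟨y, hy⟩ := exists_linearIndependent_pair_of_one_lt_finrank h3 hx
  rw [LinearIndependent.pair_iff] at hy
  have key : ∀ z : LinearMap.ker g, ∀ n : ℤ, 1 ≤ n → n < d → cf θ n (z.1.1) = 0 := by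
    intro z n h1 h2
    have hz := z.2
    rw [LinearMap.mem_ker] at hz
    have := congrFun hz ⟨(n - 1).toNat, by omega⟩
    simp only [g, LinearMap.pi_apply, LinearMap.comp_apply, Submodule.subtype_apply, Pi.zero_apply] at this
    convert this using 2
    congr 1
    omega
  refine ⟨x.1.1, y.1.1, ?_, ?_, ?_, Polynomial.mem_degreeLT.1 x.1.2, Polynomial.mem_degreeLT.1 y.1.2,
    fun n h1 h2 => ⟨key x n h1 h2, key y n h1 h2⟩⟩
  · intro h
    apply hx
    exact Subtype.ext (Subtype.ext h)
  · intro h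
    have : y = 0 := Subtype.ext (Subtype.ext h)
    have := hy 0 1 (by simp [this])
    simp at this
  · intro h
    have : x + y = 0 := Subtype.ext (Subtype.ext h)
    have := hy 1 1 (by simp [this])
    simp at this

theorem exists_good (θ : LL) {d : ℕ} (hd : 1 ≤ d) : ∃ Q : (ZMod 2)[X], Q ≠ 0 ∧
    (Q.degree < ((d + 1 : ℕ) : WithBot ℕ)) ∧ (∀ n : ℤ, 1 ≤ n → n < d → cf θ n Q = 0) ∧
    ((Q.coeff d = 0 ∧ cf θ d Q = 0) ∨ (Q.coeff d = 0 ∧ Q.coeff 0 = 0) ∨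
     (Q.coeff d = 0 ∧ cf θ 0 Q = 0) ∨ (cf θ d Q = 0 ∧ Q.coeff 0 = 0) ∨
     (cf θ d Q = 0 ∧ cf θ 0 Q = 0) ∨ (Q.coeff 0 = 0 ∧ cf θ 0 Q = 0)) := by
  obtain ⟨a, b, ha, hb, hab, hda, hdb, h⟩ := exists_pair θ hd
  rcases f2_pigeon (a.coeff d) (cf θ d a) (a.coeff 0) (cf θ 0 a)
    (b.coeff d) (cf θ d b) (b.coeff 0) (cf θ 0 b) with H | H | H
  · exact ⟨a, ha, hda, fun n h1 h2 => (h n h1 h2).1, H⟩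
  · exact ⟨b, hb, hdb, fun n h1 h2 => (h n h1 h2).2, H⟩
  · refine ⟨a + b, hab, lt_of_le_of_lt (Polynomial.degree_add_le _ _) (max_lt hda hdb), fun n h1 h2 => ?_, ?_⟩
    · rw [map_add, (h n h1 h2).1, (h n h1 h2).2, add_zero]
    · simpa only [map_add, Polynomial.coeff_add] using H

theorem plus (η : LL) {d : ℕ} (hd : 1 ≤ d) :
    SV (tt * η) d d ∨ SV (tt * (tt * η)) (d - 1) (d - 1) ∨ SV η d d ∨ SV (tt * (tt * η)) d d ∨
      SV η (d + 1) (d + 1) := by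
  set θ := tt * η with hθ
  obtain ⟨Q, hQ, hdeg, hc, H⟩ := exists_good θ hd
  obtain ⟨P', hP'⟩ := exists_poly (ev Q * θ)
  set P := -P' with hP
  have herr : ev Q * θ + ev P = ev Q * θ - polyPart (ev Q * θ) := by
    rw [hP, map_neg, hP']; ring
  have e0 : og (ev Q * θ + ev P) d := by
    rw [herr, og_iff]
    intro n hn
    rw [HahnSeries.coeff_sub, polyPart_coeff]
    split_ifs with h
    · simp
    · rw [sub_zero]; exact hc n (by omega) hn
  have e1 : cf θ d Q = 0 → og (ev Q * θ + ev P) (d + 1) := by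
    intro h
    rw [og_iff] at *
    intro n hn
    rcases lt_or_eq_of_le (Int.lt_add_one_iff.1 hn) with h' | h'
    · exact e0 n h'
    · rw [h', herr, HahnSeries.coeff_sub, polyPart_coeff, if_neg (by omega), sub_zero]
      exact h
  have q0 : og (ev Q) (-(d : ℤ)) := og_ev.2 hdeg
  have q1 : Q.coeff d = 0 → og (ev Q) (1 - (d : ℤ)) := by
    intro h
    rw [og_iff] at *
    intro n hn
    rcases lt_or_eq_of_le (show n ≤ -(d : ℤ) by omega) with h' | h'
    · exact q0 n h'
    · rw [ev_coeff, if_pos (by omega), h']; simpa using h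
  have tQ : Q.coeff 0 = 0 → ∃ Q', Q' ≠ 0 ∧ ev Q = tt * ev Q' := by
    intro h
    obtain ⟨Q', h'⟩ := Polynomial.X_dvd_iff.2 h
    refine ⟨Q', ?_, ?_⟩
    · rintro rfl; apply hQ; rw [h']; simp
    · rw [h', map_mul, ev_X]
  have tP : cf θ 0 Q = 0 → ∃ P'', ev P = tt * ev P'' := by
    intro h
    have : P.coeff 0 = 0 := by
      have h1 := ev_coeff P' 0
      rw [hP', polyPart_coeff] at h1
      rw [cf_apply] at h
      rw [if_pos le_rfl, h] at h1
      simp at h1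
      simp [hP, ← h1]
    obtain ⟨Q', h'⟩ := Polynomial.X_dvd_iff.2 this
    exact ⟨Q', by rw [h', map_mul, ev_X]⟩
  have mt : ∀ {f : LL} {v : ℤ}, og (tt * f) v → og f (v + 1) := by
    intro f v h
    exact (og_mul_iff tt_ne (by rw [tt_order]; omega)).1 h
  rcases H with ⟨h1, h2⟩ | ⟨h1, h2⟩ | ⟨h1, h2⟩ | ⟨h1, h2⟩ | ⟨h1, h2⟩ | ⟨h1, h2⟩
  · left
    exact ⟨P, Q, Or.inr hQ, q1 h1, e1 h2⟩
  · right; left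
    obtain ⟨Q', hQ', he⟩ := tQ h2
    refine ⟨P, Q', Or.inr hQ', ?_, ?_⟩
    · have := q1 h1
      rw [he] at this
      exact og_mono (mt this) (by omega)
    · rw [he] at e0
      rw [show ev Q' * (tt * θ) = tt * ev Q' * θ by ring]
      exact og_mono e0 (by omega)
  · right; right; left
    obtain ⟨P'', he⟩ := tP h2
    refine ⟨P'', Q, Or.inr hQ, q1 h1, ?_⟩
    rw [he, show ev Q * θ + tt * ev P'' = tt * (ev Q * η + ev P'') by rw [hθ]; ring] at e0
    exact mt e0
  · right; right; right; left
    obtain ⟨Q', hQ', he⟩ := tQ h2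
    refine ⟨P, Q', Or.inr hQ', ?_, ?_⟩
    · rw [he] at q0
      exact og_mono (mt q0) (by omega)
    · have := e1 h1
      rw [he] at this
      rw [show ev Q' * (tt * θ) = tt * ev Q' * θ by ring]
      exact this
  · right; right; right; right
    obtain ⟨P'', he⟩ := tP h2
    refine ⟨P'', Q, Or.inr hQ, og_mono q0 (by omega), ?_⟩
    have := e1 h1
    rw [he, show ev Q * θ + tt * ev P'' = tt * (ev Q * η + ev P'') by rw [hθ]; ring] at this
    exact mt this
  · left
    obtain ⟨Q', hQ', he⟩ := tQ h1
    obtain ⟨P'', he'⟩ := tP h2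
    refine ⟨P'', Q', Or.inr hQ', ?_, ?_⟩
    · rw [he] at q0
      exact og_mono (mt q0) (by omega)
    · rw [he, he', show tt * ev Q' * θ + tt * ev P'' = tt * (ev Q' * θ + ev P'') by ring] at e0
      exact mt e0

/-! ### Thue-Morse -/

abbrev TM : PowerSeries (ZMod 2) := PowerSeries.mk fun n => thueMorse n

def oddS : PowerSeries (ZMod 2) := PowerSeries.mk fun n => if n % 2 = 1 then 1 else 0

theorem tm_even (n : ℕ) : thueMorse (2 * n) = thueMorse n := by
  unfold thueMorse
  rcases Nat.eq_zero_or_pos n with rfl | h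
  · simp
  · have := Nat.digits_add 2 (by norm_num) 0 n (by norm_num) (Or.inr h.ne')
    rw [zero_add] at this
    rw [this]; simp

theorem tm_odd (n : ℕ) : thueMorse (2 * n + 1) = thueMorse n + 1 := by
  unfold thueMorse
  have := Nat.digits_add 2 (by norm_num) 1 n (by norm_num) (Or.inl one_ne_zero)
  rw [add_comm] at this
  rw [this]; simp [add_comm]

theorem TM_sq_coeff (n : ℕ) :
    (TM ^ 2).coeff n = if 2 ∣ n then thueMorse (n / 2) else 0 := by
  have h : (TM.expand 2 two_ne_zero).map (frobenius (ZMod 2) 2) = TM ^ 2 :=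
    MvPowerSeries.map_frobenius_expand 2 two_ne_zero
  rw [← h, PowerSeries.coeff_map, PowerSeries.coeff_expand]
  have hf : ∀ x : ZMod 2, frobenius (ZMod 2) 2 x = x := by
    intro x; rw [ZMod.frobenius_zmod]; rfl
  rw [hf]
  simp [TM]

theorem TM_rec : TM = (1 + PowerSeries.X) * TM ^ 2 + oddS := by
  ext n
  rw [add_mul, one_mul, map_add, map_add]
  obtain ⟨m, rfl | rfl⟩ := Nat.even_or_odd' n
  · rw [TM_sq_coeff]
    rcases m with _ | m
    · simp [TM, oddS, thueMorse]
    · rw [show 2 * (m + 1) = (2 * m + 1) + 1 by ring, PowerSeries.coeff_succ_X_mul, TM_sq_coeff]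
      rw [if_pos (by omega), if_neg (by omega)]
      have := tm_even (m + 1)
      rw [show 2 * (m + 1) = (2 * m + 1) + 1 by ring] at this
      have h2 : (2 * m + 1 + 1) / 2 = m + 1 := by omega
      have h3 : ¬ (2 * m + 1 + 1) % 2 = 1 := by omega
      simp only [TM, oddS, PowerSeries.coeff_mk, this, h2, h3]
      simp
  · rw [PowerSeries.coeff_succ_X_mul, TM_sq_coeff, TM_sq_coeff,
      if_neg (show ¬ 2 ∣ 2 * m + 1 by omega), if_pos (show 2 ∣ 2 * m by omega)]
    have h2 : (2 * m) / 2 = m := by omega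
    have h3 : (2 * m + 1) % 2 = 1 := by omega
    simp only [TM, oddS, PowerSeries.coeff_mk, tm_odd, h2, h3]
    simp

theorem odd_rec : (1 + PowerSeries.X ^ 2) * oddS = PowerSeries.X := by
  ext n
  rw [add_mul, one_mul, map_add, PowerSeries.coeff_X_pow_mul', PowerSeries.coeff_X]
  simp only [oddS, PowerSeries.coeff_mk]
  have h : (1 + 1 : ZMod 2) = 0 := rfl
  rcases n with _ | _ | n
  · simp
  · simp
  · have : n + 1 + 1 - 2 = n := by omega
    rw [this, if_pos (show 2 ≤ n + 1 + 1 by omega), if_neg (show ¬ n + 1 + 1 = 1 by omega)]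
    by_cases hn : n % 2 = 1
    · rw [if_pos (show (n + 1 + 1) % 2 = 1 by omega), if_pos hn, h]
    · rw [if_neg (show ¬ (n + 1 + 1) % 2 = 1 by omega), if_neg hn]; simp

theorem two_PS : (2 : PowerSeries (ZMod 2)) = 0 := by
  have : (2 : PowerSeries (ZMod 2)) = algebraMap (ZMod 2) _ 2 := (map_ofNat (algebraMap (ZMod 2) _) 2).symm
  rw [this, show (2 : ZMod 2) = 0 from rfl, map_zero]

theorem TM_eq : (1 + PowerSeries.X) ^ 2 * TM = (1 + PowerSeries.X) ^ 3 * TM ^ 2 + PowerSeries.X := by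
  have h1 := TM_rec
  have h2 := odd_rec
  linear_combination (1 + PowerSeries.X) ^ 2 * h1 + h2 + PowerSeries.X * oddS * two_PS

theorem tt_inv : HahnSeries.ofPowerSeries ℤ (ZMod 2) PowerSeries.X * tt = 1 := by
  rw [HahnSeries.ofPowerSeries_X, tt, tLS, HahnSeries.single_mul_single]
  simp

theorem tm_eq : (tt + 1) ^ 3 * tmSeries ^ 2 = (tt + 1) ^ 2 * tt * tmSeries + tt ^ 2 := by
  have h := congrArg (HahnSeries.ofPowerSeries ℤ (ZMod 2)) TM_eq
  simp only [map_mul, map_add, map_pow, map_one] at h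
  have hx := tt_inv
  change (_ : LL) = _ at h
  set x := HahnSeries.ofPowerSeries ℤ (ZMod 2) PowerSeries.X with hxd
  change (1 + x) ^ 2 * tmSeries = (1 + x) ^ 3 * tmSeries ^ 2 + x at h
  have hs : tt + 1 = tt * (1 + x) := by linear_combination -hx
  rw [hs]
  linear_combination (-tt ^ 3) * h + tt ^ 2 * hx - tt ^ 3 * x * two_LL

def phi : LL := (tt + 1) ^ 2 * tmSeries * tt⁻¹

theorem phi_eq : phi ^ 2 = (tt + 1) * phi + (tt + 1) := by
  have h := tm_eq
  have h0 := tt_ne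
  unfold phi
  field_simp
  linear_combination (tt + 1) * h

theorem phi_tm (k : ℕ) : (tt + 1) ^ 2 * (tt ^ k * tmSeries) = tt ^ (k + 1) * phi := by
  have h0 := tt_ne
  unfold phi
  field_simp
  ring

/-- irrationality -/
def Irr (θ : LL) : Prop := ∀ P Q : (ZMod 2)[X], ev Q * θ + ev P = 0 → Q = 0

theorem descent (n : ℕ) : ∀ P A : (ZMod 2)[X], A.natDegree ≤ n →
    (X - C 1) * P ^ 2 + X * (X - C 1) * P * A + X ^ 2 * A ^ 2 = 0 → A = 0 := by
  induction n with
  | zero =>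
    intro P A hA h
    have h1 := congrArg (Polynomial.eval 1) h
    simp at h1
    rw [Polynomial.eq_C_of_natDegree_le_zero hA] at h1 ⊢
    simpa using h1
  | succ n ih =>
    intro P A hA h
    by_contra hne
    have h1 := congrArg (Polynomial.eval 1) h
    simp at h1
    obtain ⟨B, rfl⟩ := Polynomial.dvd_iff_isRoot.2 h1
    have hs : (X - C 1 : (ZMod 2)[X]) ≠ 0 := Polynomial.X_sub_C_ne_zero 1
    have hB : B ≠ 0 := by rintro rfl; simp at hne
    have h2 : P ^ 2 + X * (X - C 1) * P * B + X ^ 2 * (X - C 1) * B ^ 2 = 0 := by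
      apply mul_left_cancel₀ hs
      linear_combination h
    have h3 := congrArg (Polynomial.eval 1) h2
    simp at h3
    obtain ⟨R, rfl⟩ := Polynomial.dvd_iff_isRoot.2 h3
    have h4 : (X - C 1) * R ^ 2 + X * (X - C 1) * R * B + X ^ 2 * B ^ 2 = 0 := by
      apply mul_left_cancel₀ hs
      linear_combination h2
    apply hB
    apply ih R B _ h4
    rw [Polynomial.natDegree_mul hs hB, Polynomial.natDegree_X_sub_C] at hA
    omega

theorem ev_XC : ev (X - C 1) = tt + 1 := by
  rw [map_sub, ev_X, map_one, map_one]
  linear_combination - two_LL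

theorem irr_tm (k : ℕ) : Irr (tt ^ k * tmSeries) := by
  intro P Q h
  have hA : ev (Q * X ^ k) = ev Q * tt ^ k := by simp
  have h1 : (X - C 1) ^ 3 * P ^ 2 + X * (X - C 1) ^ 2 * P * (Q * X ^ k)
      + X ^ 2 * (Q * X ^ k) ^ 2 = 0 := by
    rw [← ev_inj]
    simp only [map_add, map_mul, map_pow, ev_XC, ev_X]
    have hP : ev P = - (ev Q * tt ^ k * tmSeries) := by linear_combination h
    rw [hP]
    linear_combination (ev Q * tt ^ k) ^ 2 * tm_eq + (ev Q * tt ^ k) ^ 2 * tt ^ 2 * two_LL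
  have h2 := congrArg (Polynomial.eval 1) h1
  simp at h2
  obtain ⟨B, hB⟩ := Polynomial.dvd_iff_isRoot.2 (show (Q * X ^ k).IsRoot 1 by simpa using h2)
  have hs : (X - C 1 : (ZMod 2)[X]) ≠ 0 := Polynomial.X_sub_C_ne_zero 1
  rw [hB] at h1
  have h3 : (X - C 1) * P ^ 2 + X * (X - C 1) * P * B + X ^ 2 * B ^ 2 = 0 := by
    apply mul_left_cancel₀ (pow_ne_zero 2 hs)
    linear_combination h1
  have := descent _ P B le_rfl h3
  rw [this, mul_zero] at hB
  rcases mul_eq_zero.1 hB with h | h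
  · exact h
  · exact absurd h (pow_ne_zero _ X_ne_zero)

theorem quad_tm (k : ℕ) : ev ((X - C 1) ^ 3) * (tt ^ k * tmSeries) ^ 2 +
    ev (X ^ (k + 1) * (X - C 1) ^ 2) * (tt ^ k * tmSeries) + ev (X ^ (2 * k + 2)) = 0 := by
  rw [map_mul, map_pow, map_pow, map_pow, map_pow, ev_XC, ev_X]
  linear_combination (tt ^ k) ^ 2 * tm_eq + (tt ^ (2 * k + 1) * (tt + 1) ^ 2 * tmSeries + tt ^ (2 * k + 2)) * two_LL

theorem SV_tm {k : ℕ} {u v : ℤ} (h : SV (tt ^ (k + 1) * phi) u v) :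
    SV (tt ^ k * tmSeries) (u + 2) v := by
  obtain ⟨P, Q, h0, h1, h2⟩ := h
  refine ⟨P, (X - C 1) ^ 2 * Q, ?_, ?_, ?_⟩
  · rcases h0 with h | h
    · exact Or.inl h
    · exact Or.inr (mul_ne_zero (pow_ne_zero _ (Polynomial.X_sub_C_ne_zero 1)) h)
  · rw [map_mul, map_pow, ev_XC, pow_two]
    exact og_mono (og_mul (og_mul og_s og_s) h1) (by omega)
  · have : ev ((X - C 1) ^ 2 * Q) * (tt ^ k * tmSeries) = ev Q * (tt ^ (k + 1) * phi) := by
      rw [map_mul, map_pow, ev_XC, ← phi_tm]; ring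
    rwa [this]

/-! ### Continued fractions -/

abbrev nxt (θ : LL) : LL := (θ - polyPart θ)⁻¹

theorem cfQuot_shift (θ : LL) (i : ℕ) : cfQuot θ (i + 1) = cfQuot (nxt θ) i := by
  induction i with
  | zero => rfl
  | succ i ih => rw [cfQuot, ih]; rfl

theorem frac_ne {θ : LL} (h : Irr θ) : θ - polyPart θ ≠ 0 := by
  intro h0
  obtain ⟨A, hA⟩ := exists_poly θ
  have := h (-A) 1 (by rw [map_one, map_neg, hA]; linear_combination h0)
  exact one_ne_zero this

theorem irr_nxt {θ : LL} (h : Irr θ) : Irr (nxt θ) := by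
  intro P Q hPQ
  have hf := frac_ne h
  obtain ⟨A, hA⟩ := exists_poly θ
  have h1 : ev P * θ + ev (Q - P * A) = 0 := by
    rw [map_sub, map_mul, hA]
    have : nxt θ * (θ - polyPart θ) = 1 := inv_mul_cancel₀ hf
    linear_combination (θ - polyPart θ) * hPQ - ev Q * this
  have hP := h _ _ h1
  rw [hP, map_zero, add_zero] at hPQ
  rcases mul_eq_zero.1 hPQ with h' | h'
  · exact ev_inj.1 h'
  · exact absurd h' (inv_ne_zero hf)

theorem irr_cfQuot {θ : LL} (h : Irr θ) (i : ℕ) : Irr (cfQuot θ i) := by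
  induction i with
  | zero => exact h
  | succ i ih => exact irr_nxt ih

theorem frac_order {θ : LL} (h : Irr θ) : (θ - polyPart θ).order = -(nxt θ).order := by
  have hf := frac_ne h
  have : (nxt θ * (θ - polyPart θ)).order = (nxt θ).order + (θ - polyPart θ).order :=
    HahnSeries.order_mul (inv_ne_zero hf) hf
  rw [show nxt θ * (θ - polyPart θ) = 1 from inv_mul_cancel₀ hf, HahnSeries.order_one] at this
  omega

theorem nxt_order {θ : LL} (h : Irr θ) : (nxt θ).order ≤ -1 := by
  have h1 := (og_order (frac_ne h)).1 (og_frac θ)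
  have := frac_order h
  omega

theorem degZ_polyPart {f : LL} (hf : f ≠ 0) (h : f.order ≤ 0) : degZ (polyPart f) = -f.order := by
  unfold degZ
  have hc : (polyPart f).coeff f.order ≠ 0 := by
    rw [polyPart_coeff, if_pos h]
    exact HahnSeries.coeff_order_eq_zero.not.2 hf
  have hne : polyPart f ≠ 0 := by
    intro h0; rw [h0] at hc; exact hc rfl
  congr 1
  apply le_antisymm
  · exact HahnSeries.order_le_of_coeff_ne_zero hc
  · rw [← og_order hne, og_iff]
    intro n hn
    rw [polyPart_coeff]
    split_ifs
    · exact HahnSeries.coeff_eq_zero_of_lt_order hn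
    · rfl

theorem nxt_ne {θ : LL} (h : Irr θ) : nxt θ ≠ 0 := inv_ne_zero (frac_ne h)

theorem degZ_cfPQ {θ : LL} (h : Irr θ) (i : ℕ) :
    degZ (cfPQ θ (i + 1)) = -(cfQuot θ (i + 1)).order ∧ 1 ≤ degZ (cfPQ θ (i + 1)) := by
  have h1 : (cfQuot θ (i + 1)).order ≤ -1 := nxt_order (irr_cfQuot h i)
  have h2 : cfQuot θ (i + 1) ≠ 0 := nxt_ne (irr_cfQuot h i)
  have := degZ_polyPart h2 (by omega)
  unfold cfPQ
  rw [this]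
  exact ⟨rfl, by omega⟩

theorem SV_step {θ : LL} (h : Irr θ) {d : ℤ} (hd : -(nxt θ).order ≤ d) (hS : SV θ d d) :
    SV (nxt θ) (d + (nxt θ).order) (d + (nxt θ).order) := by
  obtain ⟨P, Q, h0, h1, h2⟩ := hS
  obtain ⟨A, hA⟩ := exists_poly θ
  have hf := frac_ne h
  have hfo := frac_order h
  have hno := nxt_order h
  have hinv : nxt θ * (θ - polyPart θ) = 1 := inv_mul_cancel₀ hf
  refine ⟨Q, Q * A + P, ?_, ?_, ?_⟩
  · by_cases hQ : Q = 0
    · right; subst hQ; simpa using h0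
    · exact Or.inl hQ
  · have : ev (Q * A + P) = (ev Q * θ + ev P) - ev Q * (θ - polyPart θ) := by
      rw [map_add, map_mul, hA]; ring
    rw [this]
    apply og_sub
    · exact og_mono h2 (by omega)
    · exact og_mono (og_mul h1 ((og_order hf).2 le_rfl)) (by omega)
  · have : ev (Q * A + P) * nxt θ + ev Q = nxt θ * (ev Q * θ + ev P) := by
      rw [map_add, map_mul, hA]
      linear_combination -(ev Q) * hinv
    rw [this]
    exact og_mono (og_mul ((og_order (nxt_ne h)).2 le_rfl) h2) (by omega)

theorem not_SV_zero (θ : LL) : ¬ SV θ 0 0 := by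
  rintro ⟨P, Q, h0, h1, h2⟩
  have hQ : Q = 0 := ev_eq_zero_of_og (by simpa using h1)
  subst hQ
  have hP : P = 0 := ev_eq_zero_of_og (by simpa using h2)
  subst hP
  simp at h0

/-- partial sums of degrees -/
def dsum (θ : LL) (i : ℕ) : ℤ := ∑ j ∈ Finset.range i, degZ (cfPQ θ (j + 1))

theorem dsum_nonneg {θ : LL} (h : Irr θ) (i : ℕ) : 0 ≤ dsum θ i :=
  Finset.sum_nonneg fun j _ => by have := (degZ_cfPQ h j).2; omega

theorem normal (i : ℕ) : ∀ θ : LL, Irr θ → ¬ SV θ (dsum θ i) (dsum θ i) := by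
  induction i with
  | zero => intro θ _; simpa [dsum] using not_SV_zero θ
  | succ i ih =>
    intro θ h hS
    have e : dsum θ (i + 1) = dsum (nxt θ) i - (nxt θ).order := by
      unfold dsum
      rw [Finset.sum_range_succ']
      have h1 : degZ (cfPQ θ (0 + 1)) = -(nxt θ).order := (degZ_cfPQ h 0).1
      rw [h1]
      have : ∀ j, cfPQ θ (j + 1 + 1) = cfPQ (nxt θ) (j + 1) := by
        intro j; unfold cfPQ; rw [cfQuot_shift]
      simp only [this]
      ring
    have h0 := dsum_nonneg (irr_nxt h) i
    have := SV_step h (by omega) hS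
    rw [e, sub_add_cancel] at this
    exact ih _ (irr_nxt h) this

/-- quadratic invariant -/
def QInv (b : (ZMod 2)[X]) (N : ℕ) (θ : LL) : Prop :=
  ∃ a c : (ZMod 2)[X], og (ev a) (-(N : ℤ)) ∧ og (ev c) (-(N : ℤ)) ∧
    ev a * θ ^ 2 + ev b * θ + ev c = 0

theorem QInv_nxt {b : (ZMod 2)[X]} {N : ℕ} (hb : og (ev b) (-(N : ℤ))) {θ : LL} (hi : Irr θ)
    (h : QInv b N θ) : QInv b N (nxt θ) := by
  obtain ⟨a, c, ha, hc, he⟩ := h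
  obtain ⟨A, hA⟩ := exists_poly θ
  have hinv : nxt θ * (θ - ev A) = 1 := by rw [hA]; exact inv_mul_cancel₀ (frac_ne hi)
  have hno := nxt_order hi
  have hn0 := nxt_ne hi
  set η := nxt θ with hη
  have e1 : ev (a * A ^ 2 + b * A + c) * η ^ 2 + ev b * η + ev a = 0 := by
    simp only [map_add, map_mul, map_pow]
    have hθ : η * θ = 1 + η * ev A := by linear_combination hinv
    have : ev a * (η * θ) ^ 2 + ev b * (η * θ) * η + ev c * η ^ 2 = 0 := by
      linear_combination η ^ 2 * he
    rw [hθ] at this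
    linear_combination this - ev a * η * ev A * two_LL
  refine ⟨a * A ^ 2 + b * A + c, a, ?_, ha, e1⟩
  have e2 : η * (η * ev (a * A ^ 2 + b * A + c)) = -1 * (ev b * η + ev a) := by
    linear_combination e1
  have h3 : og (ev b * η + ev a) (-(N : ℤ) + η.order) :=
    og_add (og_mul hb ((og_order hn0).2 le_rfl)) (og_mono ha (by omega))
  have h4 : og (η * (η * ev (a * A ^ 2 + b * A + c))) (-(N : ℤ) + η.order) := by
    rw [e2]
    have : og (-1 : LL) 0 := by
      rw [og_order (by simp), HahnSeries.order_neg, HahnSeries.order_one]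
    exact og_mono (og_mul this h3) (by omega)
  have h5 := og_of_mul hn0 (og_of_mul hn0 h4)
  exact og_mono h5 (by omega)

theorem finite_F (N : ℕ) : {p : (ZMod 2)[X] | og (ev p) (-(N : ℤ))}.Finite := by
  have : Module.Finite (ZMod 2) (Polynomial.degreeLT (ZMod 2) (N + 1)) :=
    Module.Finite.equiv (Polynomial.degreeLTEquiv (ZMod 2) (N + 1)).symm
  have h2 : Finite (Polynomial.degreeLT (ZMod 2) (N + 1)) := Module.finite_of_finite (ZMod 2)
  have h3 : ((Polynomial.degreeLT (ZMod 2) (N + 1) : Submodule _ _) : Set (ZMod 2)[X]).Finite :=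
    Set.toFinite _
  apply h3.subset
  intro p hp
  exact Polynomial.mem_degreeLT.2 (og_ev.1 hp)

theorem finite_QInv {b : (ZMod 2)[X]} (hb : b ≠ 0) (N : ℕ) : {θ : LL | QInv b N θ}.Finite := by
  have h : (⋃ a ∈ {p : (ZMod 2)[X] | og (ev p) (-(N : ℤ))},
      ⋃ c ∈ {p : (ZMod 2)[X] | og (ev p) (-(N : ℤ))},
        {x : LL | ev a * x ^ 2 + ev b * x + ev c = 0}).Finite := by
    refine (finite_F N).biUnion fun a _ => (finite_F N).biUnion fun c _ => ?_
    have hp : (Polynomial.C (ev a) * X ^ 2 + Polynomial.C (ev b) * X + Polynomial.C (ev c) : LL[X]) ≠ 0 := by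
      intro h
      have := congrArg (fun p => Polynomial.coeff p 1) h
      simp [Polynomial.coeff_X, Polynomial.coeff_C, Polynomial.coeff_X_pow] at this
      exact hb (ev_inj.1 this)
    refine (Polynomial.finite_setOfPred_isRoot hp).subset ?_
    intro x hx
    simpa [Polynomial.IsRoot] using hx
  apply h.subset
  rintro θ ⟨a, c, ha, hc, he⟩
  simp only [Set.mem_iUnion]
  exact ⟨a, ha, c, hc, he⟩

theorem exists_og (p : (ZMod 2)[X]) : ∃ N : ℕ, og (ev p) (-(N : ℤ)) :=
  ⟨p.natDegree, og_ev.2 (lt_of_le_of_lt Polynomial.degree_le_natDegree (by norm_cast; omega))⟩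

theorem periodic_of_quad {θ : LL} (hi : Irr θ) {a b c : (ZMod 2)[X]} (hb : b ≠ 0)
    (h : ev a * θ ^ 2 + ev b * θ + ev c = 0) : ∃ s : ℕ × ℕ, PeriodWindow θ s.1 s.2 := by
  obtain ⟨N1, h1⟩ := exists_og a
  obtain ⟨N2, h2⟩ := exists_og b
  obtain ⟨N3, h3⟩ := exists_og c
  set N := N1 + N2 + N3 with hN
  have hq : ∀ i, QInv b N (cfQuot θ i) := by
    intro i
    induction i with
    | zero => exact ⟨a, c, og_mono h1 (by omega), og_mono h3 (by omega), h⟩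
    | succ i ih => exact QInv_nxt (og_mono h2 (by omega)) (irr_cfQuot hi i) ih
  obtain ⟨i, _, j, _, hne, hij⟩ := Set.infinite_univ.exists_ne_map_eq_of_mapsTo
    (f := cfQuot θ) (t := {θ : LL | QInv b N θ}) (fun i _ => hq i) (finite_QInv hb N)
  wlog hlt : i < j generalizing i j
  · exact this j trivial i trivial hne.symm hij.symm (by omega)
  refine ⟨(i, j - i), by simp; omega, ?_⟩
  have key : ∀ n, cfQuot θ (i + n + (j - i)) = cfQuot θ (i + n) := by
    intro n
    induction n with
    | zero => rw [add_zero, show i + (j - i) = j by omega, hij]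
    | succ n ih =>
      rw [show i + (n + 1) + (j - i) = (i + n + (j - i)) + 1 by omega, cfQuot, ih]
      rfl
  intro m hm
  have := key (m - i)
  unfold cfPQ
  rw [show i + (m - i) = m by simp at hm; omega] at this
  simp only [this]

theorem periodic_tm (k : ℕ) : ∃ s : ℕ × ℕ, PeriodWindow (tt ^ k * tmSeries) s.1 s.2 :=
  periodic_of_quad (irr_tm k) (mul_ne_zero (pow_ne_zero _ X_ne_zero)
    (pow_ne_zero _ (Polynomial.X_sub_C_ne_zero 1))) (quad_tm k)

/-! ### Counting -/

def Al (c d : ℕ) : Prop := d ≤ c ∧ ¬ SV (tt ^ (c - d) * phi) d d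

theorem row_up {k i : ℕ} {u v : ℤ} (h : SV (tt ^ k * phi) u v) : SV (tt ^ (k + i) * phi) u (v - i) := by
  induction i with
  | zero => simpa using h
  | succ i ih =>
    have := SV_up ih
    rw [← mul_assoc, ← pow_succ'] at this
    rw [← add_assoc]
    exact SV_mono this le_rfl (by push_cast; omega)

theorem row_down {k i : ℕ} {u v : ℤ} (h : SV (tt ^ (k + i) * phi) u v) : SV (tt ^ k * phi) (u + i) v := by
  induction i generalizing u with
  | zero => simpa using h
  | succ i ih =>
    rw [← add_assoc, pow_succ', mul_assoc] at h
    have := ih (SV_down h)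
    exact SV_mono this (by push_cast; omega) le_rfl

theorem row_scale {k : ℕ} {d : ℤ} (h : SV (tt ^ k * phi) d d) (r : ℕ) :
    SV (tt ^ (2 ^ r * k) * phi) (2 ^ r * d) (2 ^ r * (d + 1) - 1) := by
  induction r with
  | zero => simpa using h
  | succ r ih =>
    have := SV_double phi_eq ih
    rw [show 2 ^ (r + 1) * k = 2 * (2 ^ r * k) by ring]
    exact SV_mono this (by rw [pow_succ]; linarith) (by rw [pow_succ]; linarith)

/-- the block lemma -/
theorem block {r C D x y z : ℕ} (hDC : D ≤ C) (hx : x < 2 ^ r) (hy : y < 2 ^ r) (hzx : z ≤ x)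
    (hzy : z ≤ y)
    (hle : 2 ^ r * D + y ≤ 2 ^ r * C + x) (h : SV (tt ^ (C - D) * phi) D D) :
    SV (tt ^ (2 ^ r * C + x - (2 ^ r * D + y)) * phi) ((2 ^ r * D + y : ℕ) - z : ℤ) (2 ^ r * D + y : ℕ) := by
  have h1 := row_scale h r
  obtain ⟨e, rfl⟩ := Nat.exists_eq_add_of_le hDC
  rw [Nat.add_sub_cancel_left] at h1
  have hx' : (x : ℤ) < 2 ^ r := by exact_mod_cast hx
  have hy' : (y : ℤ) < 2 ^ r := by exact_mod_cast hy
  rcases le_total y x with hyx | hxy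
  · obtain ⟨i, rfl⟩ := Nat.exists_eq_add_of_le hyx
    have h2 := row_up (i := i) h1
    have e1 : 2 ^ r * (D + e) + (y + i) - (2 ^ r * D + y) = 2 ^ r * e + i := by
      rw [mul_add]; omega
    rw [e1]
    refine SV_mono h2 ?_ ?_
    · push_cast; omega
    · push_cast at *; linarith
  · obtain ⟨i, rfl⟩ := Nat.exists_eq_add_of_le hxy
    have e1 : 2 ^ r * e = (2 ^ r * (D + e) + x - (2 ^ r * D + (x + i))) + i := by
      rw [mul_add] at *; omega
    rw [e1] at h1
    have h2 := row_down h1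
    refine SV_mono h2 ?_ ?_
    · push_cast; omega
    · push_cast at *; linarith

theorem Al_div (r : ℕ) {c d : ℕ} (h : Al c d) : Al (c / 2 ^ r) (d / 2 ^ r) := by
  obtain ⟨h1, h2⟩ := h
  refine ⟨Nat.div_le_div_right h1, fun hS => h2 ?_⟩
  have hp : 0 < 2 ^ r := by positivity
  have := block (r := r) (x := c % 2 ^ r) (y := d % 2 ^ r) (z := 0) (Nat.div_le_div_right h1)
    (Nat.mod_lt _ hp) (Nat.mod_lt _ hp) (Nat.zero_le _) (Nat.zero_le _)
    (by rw [Nat.div_add_mod, Nat.div_add_mod]; exact h1) hS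
  rw [Nat.div_add_mod, Nat.div_add_mod] at this
  simpa using this

theorem Al_dead (C D : ℕ) : ∃ i < 4, ∃ j < 4, ¬ Al (4 * C + i) (4 * D + j) := by
  by_cases hCD : C ≤ D
  · exact ⟨0, by norm_num, 1, by norm_num, fun h => by have := h.1; omega⟩
  · by_contra! hall
    obtain ⟨e, rfl⟩ := Nat.exists_eq_add_of_le (show D ≤ C by omega)
    have he : 1 ≤ e := by omega
    have hp := plus (tt ^ (4 * e) * phi) (d := 4 * D + 1) (by omega)
    rw [← mul_assoc tt, ← pow_succ', ← mul_assoc tt, ← pow_succ'] at hp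
    have key : ∀ i < 4, ∀ j < 4, ∀ K, K + 4 * D + j = 4 * (D + e) + i → ¬ SV (tt ^ K * phi) (4 * D + j : ℕ) (4 * D + j : ℕ) := by
      intro i hi j hj K hK
      have := (hall i hi j hj).2
      rwa [show 4 * (D + e) + i - (4 * D + j) = K by omega] at this
    rcases hp with h | h | h | h | h
    · exact key 2 (by norm_num) 1 (by norm_num) _ (by ring) h
    · refine key 2 (by norm_num) 0 (by norm_num) _ (by ring) (SV_mono h ?_ ?_) <;> push_cast <;> omega
    · exact key 1 (by norm_num) 1 (by norm_num) _ (by ring) h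
    · exact key 3 (by norm_num) 1 (by norm_num) _ (by ring) h
    · refine key 2 (by norm_num) 2 (by norm_num) _ (by ring) (SV_mono h ?_ ?_) <;> push_cast <;> omega

/-- block sums -/
def bl (W : ℕ) (f : ℕ → ℕ → ℕ) (C D : ℕ) : ℕ :=
  ∑ i ∈ Finset.range W, ∑ j ∈ Finset.range W, f (W * C + i) (W * D + j)

theorem sum_range_mul' (n W : ℕ) (g : ℕ → ℕ) :
    ∑ x ∈ Finset.range (n * W), g x = ∑ p ∈ Finset.range n, ∑ i ∈ Finset.range W, g (W * p + i) := by
  induction n with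
  | zero => simp
  | succ n ih =>
    rw [Finset.sum_range_succ, ← ih, add_mul, one_mul, Finset.sum_range_add, mul_comm n W]

theorem bl_mul (n W : ℕ) (f : ℕ → ℕ → ℕ) (C D : ℕ) :
    bl (n * W) f C D = ∑ p ∈ Finset.range n, ∑ q ∈ Finset.range n, bl W f (n * C + p) (n * D + q) := by
  unfold bl
  rw [sum_range_mul' n W]
  refine Finset.sum_congr rfl fun p _ => ?_
  rw [Finset.sum_comm (s := Finset.range n)]
  refine Finset.sum_congr rfl fun i _ => ?_
  rw [sum_range_mul' n W]
  refine Finset.sum_congr rfl fun q _ => Finset.sum_congr rfl fun j _ => ?_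
  congr 1 <;> ring

def iA (c d : ℕ) : ℕ := if Al c d then 1 else 0

theorem bl_dead (m : ℕ) {C D : ℕ} (h : ¬ Al C D) : bl (4 ^ m) iA C D = 0 := by
  unfold bl
  refine Finset.sum_eq_zero fun i hi => Finset.sum_eq_zero fun j hj => ?_
  rw [Finset.mem_range] at hi hj
  unfold iA
  rw [if_neg]
  intro hA
  apply h
  have := Al_div (2 * m) hA
  rw [pow_mul, show (2 ^ 2 : ℕ) = 4 from rfl, Nat.mul_add_div (by positivity), Nat.mul_add_div (by positivity),
    Nat.div_eq_of_lt hi, Nat.div_eq_of_lt hj] at this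
  simpa using this

theorem bl_A (m : ℕ) : ∀ C D, bl (4 ^ m) iA C D ≤ 15 ^ m := by
  induction m with
  | zero =>
    intro C D
    simp only [bl, iA, pow_zero, Finset.range_one, Finset.sum_singleton]
    split_ifs <;> simp
  | succ m ih =>
    intro C D
    rw [pow_succ', bl_mul, ← Finset.sum_product']
    obtain ⟨i, hi, j, hj, hd⟩ := Al_dead C D
    have hmem : (i, j) ∈ Finset.range 4 ×ˢ Finset.range 4 := by simp [hi, hj]
    rw [← Finset.add_sum_erase _ _ hmem]
    simp only
    rw [bl_dead m hd, zero_add]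
    calc _ ≤ ∑ x ∈ (Finset.range 4 ×ˢ Finset.range 4).erase (i, j), 15 ^ m :=
          Finset.sum_le_sum fun x _ => ih _ _
      _ = 15 ^ (m + 1) := by
          rw [Finset.sum_const, Finset.card_erase_of_mem hmem]
          simp [pow_succ']

/-- indicator for the Thue-Morse wall -/
def iB (c d : ℕ) : ℕ := if d + 1 ≤ c ∧ ¬ SV (tt ^ (c - d - 1) * tmSeries) d d then 1 else 0

theorem iB_le (c d : ℕ) : iB c d ≤ 1 := by unfold iB; split_ifs <;> simp

theorem iB_zero {r C D x y : ℕ} (hx : x < 2 ^ r) (hy : y < 2 ^ r) (hzx : 2 ≤ x) (hzy : 2 ≤ y)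
    (h : ¬ Al C D) : iB (2 ^ r * C + x) (2 ^ r * D + y) = 0 := by
  unfold iB
  rw [if_neg]
  rintro ⟨h1, h2⟩
  apply h
  have hDC : D ≤ C := by
    by_contra! hlt
    have : 2 ^ r * (C + 1) ≤ 2 ^ r * D := Nat.mul_le_mul_left _ hlt
    rw [mul_add] at this
    omega
  refine ⟨hDC, fun hS => h2 ?_⟩
  have := block hDC hx hy hzx hzy (by omega) hS
  obtain ⟨K, hK⟩ : ∃ K, 2 ^ r * C + x - (2 ^ r * D + y) = K + 1 := ⟨2 ^ r * C + x - (2 ^ r * D + y) - 1, by omega⟩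
  rw [hK] at this
  rw [hK, Nat.add_sub_cancel]
  have := SV_tm this
  exact SV_mono this (by push_cast; omega) le_rfl

theorem bl_R (r C D : ℕ) : bl (2 ^ r) iB C D ≤ (2 ^ r) ^ 2 * iA C D + 4 * 2 ^ r := by
  by_cases h : Al C D
  · have : iA C D = 1 := if_pos h
    rw [this]
    have : bl (2 ^ r) iB C D ≤ ∑ i ∈ Finset.range (2 ^ r), ∑ j ∈ Finset.range (2 ^ r), 1 :=
      Finset.sum_le_sum fun i _ => Finset.sum_le_sum fun j _ => iB_le _ _
    simp at this
    exact le_trans this (by rw [mul_one, pow_two]; exact Nat.le_add_right _ _)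
  · have : iA C D = 0 := if_neg h
    rw [this, mul_zero, zero_add]
    have h2 : ∀ n : ℕ, ∑ i ∈ Finset.range n, (if i < 2 then 1 else 0) ≤ 2 := by
      intro n
      rw [← Finset.card_filter]
      calc _ ≤ (Finset.range 2).card := Finset.card_le_card (by
            intro i hi; simp at hi ⊢; omega)
        _ = 2 := by simp
    calc bl (2 ^ r) iB C D ≤ ∑ i ∈ Finset.range (2 ^ r), ∑ j ∈ Finset.range (2 ^ r),
          ((if i < 2 then 1 else 0) + (if j < 2 then 1 else 0)) := by
          refine Finset.sum_le_sum fun i hi => Finset.sum_le_sum fun j hj => ?_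
          rw [Finset.mem_range] at hi hj
          have := iB_le (2 ^ r * C + i) (2 ^ r * D + j)
          by_cases h1 : i < 2
          · rw [if_pos h1]; omega
          · by_cases h2 : j < 2
            · rw [if_pos h2]; omega
            · rw [iB_zero hi hj (by omega) (by omega) h]; omega
      _ = 2 ^ r * (∑ i ∈ Finset.range (2 ^ r), (if i < 2 then 1 else 0)) +
          2 ^ r * (∑ i ∈ Finset.range (2 ^ r), (if i < 2 then 1 else 0)) := by
          simp only [Finset.sum_add_distrib]
          congr 1
          · simp only [Finset.sum_const, Finset.card_range, smul_eq_mul, Finset.mul_sum]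
          · simp only [Finset.sum_const, Finset.card_range, smul_eq_mul]
      _ ≤ 2 ^ r * 2 + 2 ^ r * 2 := by
          gcongr <;> exact h2 _
      _ = 4 * 2 ^ r := by ring

theorem bl_B (m r C D : ℕ) :
    bl (4 ^ m * 2 ^ r) iB C D ≤ 15 ^ m * (2 ^ r) ^ 2 + 16 ^ m * (4 * 2 ^ r) := by
  rw [bl_mul]
  calc _ ≤ ∑ p ∈ Finset.range (4 ^ m), ∑ q ∈ Finset.range (4 ^ m),
        ((2 ^ r) ^ 2 * iA (4 ^ m * C + p) (4 ^ m * D + q) + 4 * 2 ^ r) :=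
        Finset.sum_le_sum fun i _ => Finset.sum_le_sum fun j _ => bl_R _ _ _
    _ = (2 ^ r) ^ 2 * bl (4 ^ m) iA C D + 16 ^ m * (4 * 2 ^ r) := by
        simp only [Finset.sum_add_distrib, bl, Finset.mul_sum]
        congr 1
        simp only [Finset.sum_const, Finset.card_range, smul_eq_mul]
        rw [show (16 : ℕ) = 4 * 4 from rfl, mul_pow]; ring
    _ ≤ _ := by
        have := bl_A m C D
        rw [mul_comm (15 ^ m)]
        gcongr

theorem strip (W T M F : ℕ) (hW : 0 < W) (hT : ∀ C D, bl W iB C D ≤ T) :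
    ∑ k ∈ Finset.Icc 1 M, ∑ d ∈ Finset.range (F * W), iB (k + 1 + d) d ≤ F * ((M / W + 3) * T) := by
  set G := M / W + 3 with hG
  have hGW : M + W + 1 ≤ G * W := by
    have := Nat.lt_div_mul_add (a := M) hW
    rw [hG, add_mul]; omega
  rw [Finset.sum_comm, sum_range_mul' F W]
  have : ∀ E ∈ Finset.range F, ∑ j ∈ Finset.range W, ∑ k ∈ Finset.Icc 1 M, iB (k + 1 + (W * E + j)) (W * E + j)
      ≤ G * T := by
    intro E _
    calc _ ≤ ∑ j ∈ Finset.range W, ∑ x ∈ Finset.range (G * W), iB (W * E + x) (W * E + j) := by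
          refine Finset.sum_le_sum fun j hj => ?_
          rw [Finset.mem_range] at hj
          have hinj : Set.InjOn (fun k => k + 1 + j) (Finset.Icc 1 M : Finset ℕ) := by
            intro a _ b _ h; simpa using h
          have e : ∑ k ∈ Finset.Icc 1 M, iB (k + 1 + (W * E + j)) (W * E + j) =
              ∑ x ∈ (Finset.Icc 1 M).image (fun k => k + 1 + j), iB (W * E + x) (W * E + j) := by
            rw [Finset.sum_image hinj]
            refine Finset.sum_congr rfl fun k _ => ?_
            congr 1; ring
          rw [e]
          apply Finset.sum_le_sum_of_subset
          intro x hx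
          simp only [Finset.mem_image, Finset.mem_Icc] at hx
          obtain ⟨k, hk, rfl⟩ := hx
          rw [Finset.mem_range]; omega
      _ = ∑ p ∈ Finset.range G, bl W iB (E + p) E := by
          rw [Finset.sum_comm, sum_range_mul' G W]
          unfold bl
          refine Finset.sum_congr rfl fun p _ => Finset.sum_congr rfl fun i _ =>
            Finset.sum_congr rfl fun j _ => ?_
          congr 1; ring
      _ ≤ ∑ p ∈ Finset.range G, T := Finset.sum_le_sum fun p _ => hT _ _
      _ = G * T := by simp
  calc _ ≤ ∑ E ∈ Finset.range F, G * T := Finset.sum_le_sum this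
    _ = F * (G * T) := by simp

/-! ### Final counting argument -/

theorem dsum_strict {θ : LL} (h : Irr θ) : StrictMono (dsum θ) := by
  refine strictMono_nat_of_lt_succ fun i => ?_
  have := (degZ_cfPQ h i).2
  unfold dsum
  rw [Finset.sum_range_succ]
  omega

theorem dsum_period {θ : LL} {m l : ℕ} (h : PeriodWindow θ m l) (q : ℕ) :
    dsum θ (m + q * l) = dsum θ m + q * ∑ i ∈ Finset.Ico (m + 1) (m + 1 + l), degZ (cfPQ θ i) := by
  have hp : ∀ q j, cfPQ θ (m + q * l + j + 1) = cfPQ θ (m + j + 1) := by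
    intro q
    induction q with
    | zero => intro j; simp
    | succ q ih =>
      intro j
      rw [← ih j, ← h.2 (m + q * l + j + 1) (by omega)]
      congr 1
      ring
  induction q with
  | zero => simp
  | succ q ih =>
    have e : m + (q + 1) * l = (m + q * l) + l := by ring
    rw [e]
    have : dsum θ ((m + q * l) + l) = dsum θ (m + q * l) +
        ∑ j ∈ Finset.range l, degZ (cfPQ θ (m + q * l + j + 1)) := by
      unfold dsum
      rw [Finset.sum_range_add]
    rw [this, ih, Finset.sum_Ico_eq_sum_range]
    have : ∑ j ∈ Finset.range l, degZ (cfPQ θ (m + q * l + j + 1)) =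
        ∑ j ∈ Finset.range (m + 1 + l - (m + 1)), degZ (cfPQ θ (m + 1 + j)) := by
      rw [Nat.add_sub_cancel_left]
      refine Finset.sum_congr rfl fun j _ => ?_
      rw [hp]
      congr 2
      omega
    rw [this]
    push_cast
    ring

theorem count_le (k N D : ℕ) (h : ∀ i < N, dsum (tt ^ k * tmSeries) i < D) :
    N ≤ ∑ d ∈ Finset.range D, iB (k + 1 + d) d := by
  have hi := irr_tm k
  set θ := tt ^ k * tmSeries with hθ
  have h1 : ((Finset.range N).image fun i => (dsum θ i).toNat) ⊆ Finset.range D := by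
    intro d hd
    obtain ⟨i, hi', rfl⟩ := Finset.mem_image.1 hd
    have := h i (Finset.mem_range.1 hi')
    have := dsum_nonneg hi i
    simp only [Finset.mem_range]
    omega
  have hinj : Function.Injective fun i => (dsum θ i).toNat := by
    intro i j hij
    apply (dsum_strict hi).injective
    have := dsum_nonneg hi i
    have := dsum_nonneg hi j
    simp only at hij
    omega
  calc N = ((Finset.range N).image fun i => (dsum θ i).toNat).card := by
        rw [Finset.card_image_of_injective _ hinj, Finset.card_range]
    _ = ∑ d ∈ (Finset.range N).image fun i => (dsum θ i).toNat, 1 := by simp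
    _ ≤ ∑ d ∈ (Finset.range N).image fun i => (dsum θ i).toNat, iB (k + 1 + d) d := by
        refine Finset.sum_le_sum fun d hd => ?_
        obtain ⟨i, _, rfl⟩ := Finset.mem_image.1 hd
        have hn := normal i θ hi
        have h0 := dsum_nonneg hi i
        have e : k + 1 + (dsum θ i).toNat - (dsum θ i).toNat - 1 = k := by omega
        unfold iB
        rw [if_pos]
        refine ⟨by omega, ?_⟩
        rw [e, Int.toNat_of_nonneg h0]
        exact hn
    _ ≤ _ := Finset.sum_le_sum_of_subset h1

theorem bad_count {ε : ℝ} (hε : 0 < ε) (n k : ℕ) (hb : ¬ (1 - ε < eMass tmSeries k n)) :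
    ∃ D0 : ℕ, ∀ D ≥ D0, ε / (2 * (n + 1)) * D ≤ ((∑ d ∈ Finset.range D, iB (k + 1 + d) d : ℕ) : ℝ) := by
  have hi := irr_tm k
  have hp := periodic_tm k
  have hb' : ¬ (1 - ε < eMassOf (tt ^ k * tmSeries) n) := hb
  unfold eMassOf at hb'
  rw [dif_pos hp] at hb'
  have hw := Classical.choose_spec hp
  generalize (Classical.choose hp).1 = m at hb' hw
  generalize (Classical.choose hp).2 = l at hb' hw
  have hcnt := fun N D => count_le k N D
  generalize tt ^ k * tmSeries = θ at *
  set T : ℤ := ∑ i ∈ Finset.Ico (m + 1) (m + 1 + l), degZ (cfPQ θ i) with hT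
  have hTr : ∑ i ∈ Finset.Ico (m + 1) (m + 1 + l), (degZ (cfPQ θ i) : ℝ) = (T : ℝ) := by
    rw [hT]; push_cast; rfl
  rw [hTr] at hb'
  have hl := hw.1
  have hdeg : ∀ i ∈ Finset.Ico (m + 1) (m + 1 + l), 1 ≤ degZ (cfPQ θ i) := by
    intro i h
    rw [Finset.mem_Ico] at h
    obtain ⟨j, rfl⟩ : ∃ j, i = j + 1 := ⟨i - 1, by omega⟩
    exact (degZ_cfPQ hi j).2
  have hTl : (l : ℤ) ≤ T := by
    calc (l : ℤ) = ∑ i ∈ Finset.Ico (m + 1) (m + 1 + l), (1 : ℤ) := by simp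
      _ ≤ T := Finset.sum_le_sum hdeg
  have hnum : (T : ℝ) - n * l ≤ ∑ i ∈ Finset.Ico (m + 1) (m + 1 + l), max ((degZ (cfPQ θ i) : ℝ) - n) 0 := by
    calc (T : ℝ) - n * l = ∑ i ∈ Finset.Ico (m + 1) (m + 1 + l), ((degZ (cfPQ θ i) : ℝ) - n) := by
          rw [Finset.sum_sub_distrib, hTr]; simp; ring
      _ ≤ _ := Finset.sum_le_sum fun i _ => le_max_left _ _
  have hl0 : (1 : ℝ) ≤ l := by exact_mod_cast hl
  have hTl' : (l : ℝ) ≤ T := by exact_mod_cast hTl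
  have hT0 : (0 : ℝ) < T := by linarith
  have hmain : ε * T ≤ n * l := by
    rw [not_lt, div_le_iff₀ hT0] at hb'
    nlinarith
  have hT0' : (0 : ℤ) < T := by exact_mod_cast hT0
  obtain ⟨t, ht⟩ : ∃ t : ℕ, T = t := ⟨T.toNat, by omega⟩
  obtain ⟨s, hs⟩ : ∃ s : ℕ, dsum θ m = s := ⟨(dsum θ m).toNat, by have := dsum_nonneg hi m; omega⟩
  refine ⟨2 * (s + t), fun D hD => ?_⟩
  have ht0 : 0 < t := by omega
  set q := (D - s) / t with hq
  have hq1 : t * q ≤ D - s := Nat.mul_div_le _ _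
  have hq2 : D - s < t * q + t := by
    have := Nat.lt_mul_div_succ (D - s) ht0
    rw [← hq] at this; linarith [this]
  have hc := hcnt (m + q * l) D (by
    intro i hi'
    have h1 := dsum_strict hi hi'
    have h2 := dsum_period hw q
    rw [← hT, ht, hs] at h2
    have h3 : (t : ℤ) * q + s ≤ D := by
      have : t * q + s ≤ D := by omega
      exact_mod_cast this
    rw [h2] at h1
    linarith)
  have hc' : (q : ℝ) * l ≤ ((∑ d ∈ Finset.range D, iB (k + 1 + d) d : ℕ) : ℝ) := by
    have : q * l ≤ ∑ d ∈ Finset.range D, iB (k + 1 + d) d := by omega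
    exact_mod_cast this
  refine le_trans ?_ hc'
  have htT : (T : ℝ) = t := by rw [ht]; simp
  rw [htT] at hmain hT0
  have hq3 : (D : ℝ) ≤ 2 * (t * q) := by
    have : D ≤ 2 * (t * q) := by omega
    exact_mod_cast this
  have hn1 : (0 : ℝ) < n + 1 := by positivity
  rw [div_mul_eq_mul_div, div_le_iff₀ (by positivity)]
  have hq0 : (0 : ℝ) ≤ q := by positivity
  calc ε * D ≤ ε * (2 * (t * q)) := by gcongr
    _ = 2 * q * (ε * t) := by ring
    _ ≤ 2 * q * (n * l) := by gcongr
    _ ≤ 2 * q * ((n + 1) * l) := by gcongr; linarith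
    _ = _ := by ring

theorem bad_density {ε : ℝ} (hε : 0 < ε) (n : ℕ) (m r M : ℕ) (hM : 4 ^ m * 2 ^ r ≤ M) :
    (((Finset.Icc 1 M).filter fun k => ¬ (1 - ε < eMass tmSeries k n)).card : ℝ) * (ε / (2 * (n + 1)))
      ≤ 4 * M * ((15 / 16) ^ m + 4 / 2 ^ r) := by
  set B := (Finset.Icc 1 M).filter fun k => ¬ (1 - ε < eMass tmSeries k n) with hB
  set δ := ε / (2 * (n + 1)) with hδ
  have hδ0 : 0 < δ := by positivity
  set W := 4 ^ m * 2 ^ r with hW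
  have hW0 : 0 < W := by positivity
  have hD : ∀ k, ∃ D0 : ℕ, k ∈ B → ∀ D ≥ D0, δ * D ≤ ((∑ d ∈ Finset.range D, iB (k + 1 + d) d : ℕ) : ℝ) := by
    intro k
    by_cases hk : k ∈ B
    · obtain ⟨D0, h⟩ := bad_count hε n k (Finset.mem_filter.1 hk).2
      exact ⟨D0, fun _ => h⟩
    · exact ⟨0, fun h => absurd h hk⟩
  choose D0 hD0 using hD
  set F := 1 + ∑ k ∈ B, D0 k with hF
  have hFW : ∀ k ∈ B, D0 k ≤ F * W := by
    intro k hk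
    have : D0 k ≤ ∑ k ∈ B, D0 k := Finset.single_le_sum (fun _ _ => Nat.zero_le _) hk
    calc D0 k ≤ F := by omega
      _ ≤ F * W := Nat.le_mul_of_pos_right _ hW0
  have h1 := strip W _ M F hW0 (bl_B m r)
  have h2 : (B.card : ℝ) * (δ * (F * W)) ≤ F * ((4 * M / W) * ((15 ^ m * (2 ^ r) ^ 2 + 16 ^ m * (4 * 2 ^ r)))) := by
    calc (B.card : ℝ) * (δ * (F * W)) = ∑ k ∈ B, δ * (F * W) := by simp
      _ ≤ ∑ k ∈ B, ((∑ d ∈ Finset.range (F * W), iB (k + 1 + d) d : ℕ) : ℝ) := by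
          refine Finset.sum_le_sum fun k hk => ?_
          have := hD0 k hk (F * W) (hFW k hk)
          push_cast at this ⊢
          exact this
      _ = ((∑ k ∈ B, ∑ d ∈ Finset.range (F * W), iB (k + 1 + d) d : ℕ) : ℝ) := by push_cast; rfl
      _ ≤ ((F * ((M / W + 3) * (15 ^ m * (2 ^ r) ^ 2 + 16 ^ m * (4 * 2 ^ r))) : ℕ) : ℝ) := by
          refine Nat.cast_le.2 (le_trans ?_ h1)
          exact Finset.sum_le_sum_of_subset (Finset.filter_subset _ _)
      _ = F * ((((M / W : ℕ) : ℝ) + 3) * (15 ^ m * (2 ^ r) ^ 2 + 16 ^ m * (4 * 2 ^ r))) := by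
          push_cast; rfl
      _ ≤ _ := by
          have h3 : ((M / W : ℕ) : ℝ) ≤ M / W := Nat.cast_div_le
          have h4 : (1 : ℝ) ≤ M / W := by
            rw [le_div_iff₀ (by exact_mod_cast hW0), one_mul]; exact_mod_cast hM
          have h5 : ((M / W : ℕ) : ℝ) + 3 ≤ 4 * M / W := by
            rw [mul_div_assoc]; linarith
          gcongr
  have hFpos : (0 : ℝ) < F := by rw [hF]; positivity
  have hWr : (0 : ℝ) < W := by exact_mod_cast hW0
  have hWe : (W : ℝ) = 4 ^ m * 2 ^ r := by rw [hW]; push_cast; rfl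
  have h6 : (15 ^ m * (2 ^ r) ^ 2 + 16 ^ m * (4 * 2 ^ r) : ℝ) = W * W * ((15 / 16) ^ m + 4 / 2 ^ r) := by
    have e16 : (16 : ℝ) ^ m = 4 ^ m * 4 ^ m := by rw [← mul_pow]; norm_num
    rw [hWe, div_pow, e16]
    field_simp
  rw [h6] at h2
  have h7 : (F : ℝ) * ((4 * M / W) * (W * W * ((15 / 16) ^ m + 4 / 2 ^ r))) =
      (4 * M * ((15 / 16) ^ m + 4 / 2 ^ r)) * (F * W) := by
    field_simp
  rw [h7, ← mul_assoc] at h2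
  exact le_of_mul_le_mul_right h2 (by positivity)

theorem tm_density {ε : ℝ} (hε : 0 < ε) (n : ℕ) :
    HasDensity {k : ℕ | 1 - ε < eMass tmSeries k n} 1 := by
  unfold HasDensity
  rw [Metric.tendsto_atTop]
  intro η hη
  set δ := ε / (2 * (n + 1)) with hδ
  have hδ0 : 0 < δ := by positivity
  have hκ : 0 < η * δ / 16 := by positivity
  obtain ⟨m, hm⟩ := exists_pow_lt_of_lt_one hκ (by norm_num : (15 / 16 : ℝ) < 1)
  obtain ⟨r, hr⟩ := exists_pow_lt_of_lt_one (by positivity : 0 < η * δ / 64) (by norm_num : (1 / 2 : ℝ) < 1)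
  refine ⟨4 ^ m * 2 ^ r, fun M hM => ?_⟩
  have hM0 : 0 < M := lt_of_lt_of_le (by positivity) hM
  have hMr : (0 : ℝ) < M := by exact_mod_cast hM0
  have hb := bad_density hε n m r M hM
  rw [← hδ] at hb
  have hsum := Finset.card_filter_add_card_filter_not (s := Finset.Icc 1 M)
    (fun k => 1 - ε < eMass tmSeries k n)
  rw [Nat.card_Icc, Nat.add_sub_cancel] at hsum
  simp only [Set.mem_ofPred_eq]
  set G := ((Finset.Icc 1 M).filter fun k => 1 - ε < eMass tmSeries k n).card with hG
  set B := ((Finset.Icc 1 M).filter fun k => ¬ (1 - ε < eMass tmSeries k n)).card with hB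
  have hsr : (G : ℝ) + B = M := by exact_mod_cast hsum
  have hr' : (4 : ℝ) / 2 ^ r < η * δ / 16 := by
    rw [one_div, inv_pow] at hr
    rw [div_eq_mul_inv]; linarith
  have h8 : (B : ℝ) * δ < η * M * δ := by
    calc (B : ℝ) * δ ≤ _ := hb
      _ ≤ 4 * M * (η * δ / 16 + η * δ / 16) := by gcongr
      _ = (η * M * δ) / 2 := by ring
      _ < _ := by
        have : 0 < η * M * δ := by positivity
        linarith
  have h9 : (B : ℝ) < η * M := lt_of_mul_lt_mul_right h8 hδ0.le
  have e : (G : ℝ) / M - 1 = -(B / M) := by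
    rw [← hsr]; rw [← hsr] at hMr; field_simp; ring
  rw [Real.dist_eq, e, abs_neg, abs_of_nonneg (by positivity), div_lt_iff₀ hMr]
  exact h9

/-- The Thue–Morse Laurent series exhibits full generic escape of mass
with respect to `{t^k}`. -/
theorem thueMorse_full_generic_escape : FullGenericEscape tmSeries := by
  intro ε hε
  exact ⟨fun _ => 1, fun n => tm_density hε n, tendsto_const_nhds⟩

end EscapeOfMass
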